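/- Let φ : ℝ → ℝ be a 2π-periodic function which is differentiable with bounded derivative. Then its periodic Hilbert transform H{φ}, given by H{φ}(θ) = (1/π) ∫_0^π (φ'(θ+t) + φ'(θ−t)) ln(sin(t/2)) dt, is a continuous function of θ on ℝ. -/

import Mathlib

open Filter Set
open scoped Real

open MeasureTheory in
/-- The convolution of an integrable function with a bounded measurable function is continuous. -/
theorem continuous_integral_sub_mul_of_bounded {g k : ℝ → ℝ} {C : ℝ} (hg : Measurable g)
    (hC : ∀ x, |g x| ≤ C) (hk : Integrable k) :
    Continuous (fun θ : ℝ => ∫ t, g (θ - t) * k t) := by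
  have hint {f : ℝ → ℝ} (hf : Integrable f) (θ : ℝ) :
      Integrable (fun t => g (θ - t) * f t) :=
    hf.bdd_mul (c := C) (hg.comp (measurable_const.sub measurable_id)).aestronglyMeasurable
      (.of_forall fun t => hC _)
  have hC0 : 0 ≤ C := (abs_nonneg _).trans (hC 0)
  have hloc : LocallyIntegrable g :=
    (memLp_top_of_bound hg.aestronglyMeasurable C (.of_forall hC)).locallyIntegrable le_top
  refine continuous_of_uniform_approx_of_continuous fun u hu => ?_
  obtain ⟨ε, hε, hεu⟩ := Metric.mem_uniformity_dist.1 hu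
  obtain ⟨f, hfc, hfε, hf, hfi⟩ :=
    hk.exists_hasCompactSupport_integral_sub_le (ε := ε / (C + 1)) (by positivity)
  refine ⟨fun θ => ∫ t, g (θ - t) * f t, ?_, fun θ => hεu ?_⟩
  · have := hfc.continuous_convolution_left (ContinuousLinearMap.mul ℝ ℝ) hf hloc
    refine this.congr fun θ => ?_
    simp only [convolution_def, ContinuousLinearMap.mul_apply', mul_comm]
  · rw [Real.dist_eq, ← integral_sub (hint hk θ) (hint hfi θ)]
    calc ‖∫ t, (g (θ - t) * k t - g (θ - t) * f t)‖
        ≤ ∫ t, C * ‖k t - f t‖ := by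
          refine norm_integral_le_of_norm_le ((hk.sub hfi).norm.const_mul C) (.of_forall fun t => ?_)
          rw [← mul_sub, norm_mul]
          exact mul_le_mul_of_nonneg_right (hC _) (norm_nonneg _)
      _ = C * ∫ t, ‖k t - f t‖ := integral_const_mul _ _
      _ ≤ C * (ε / (C + 1)) := mul_le_mul_of_nonneg_left hfε hC0
      _ < ε := by
          rw [mul_div_assoc', div_lt_iff₀ (by positivity)]
          nlinarith

theorem intervalIntegrable_log_sin_half (a b : ℝ) :
    IntervalIntegrable (fun t => Real.log (Real.sin (t / 2))) MeasureTheory.volume a b := by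
  have h : AnalyticOnNhd ℝ (fun t : ℝ => Real.sin (t / 2)) univ := fun x _ => by fun_prop
  exact (h.meromorphicOn.mono_set (subset_univ _)).intervalIntegrable_log

/-- For a `2π`-periodic differentiable function `φ` with bounded derivative, the
periodic Hilbert transform
`H{φ}(θ) = (1/π) ∫_0^π (φ'(θ+t) + φ'(θ−t)) ln(sin(t/2)) dt`
is a continuous function of `θ`. -/
theorem hilbert_transform_continuous_of_bounded_derivative
    (φ : ℝ → ℝ) (hper : Function.Periodic φ (2 * π))
    (hdiff : Differentiable ℝ φ) (C : ℝ) (hC : ∀ x, |deriv φ x| ≤ C) :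
    Continuous (fun θ : ℝ =>
      (1 / π) *
        ∫ t in (0:ℝ)..π, (deriv φ (θ + t) + deriv φ (θ - t)) * Real.log (Real.sin (t / 2))) := by
  refine continuous_const.mul ?_
  set g := deriv φ with hgdef
  have hg : Measurable g := measurable_deriv φ
  set k : ℝ → ℝ := (Ioc 0 π).indicator fun t => Real.log (Real.sin (t / 2)) with hkdef
  have hk : MeasureTheory.Integrable k :=
    (intervalIntegrable_log_sin_half 0 π).1.integrable_indicator measurableSet_Ioc
  have hright := (continuous_integral_sub_mul_of_bounded (g := fun x => g (-x))
    (hg.comp measurable_neg) (fun x => hC (-x)) hk).comp continuous_neg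
  have hleft := continuous_integral_sub_mul_of_bounded hg hC hk
  refine (hright.add hleft).congr fun θ => ?_
  have hint (s : ℝ → ℝ) (hs : Measurable s) : MeasureTheory.Integrable fun t => g (s t) * k t :=
    hk.bdd_mul (c := C) (hg.comp hs).aestronglyMeasurable (.of_forall fun t => hC _)
  have hneg (t : ℝ) : -(-θ - t) = θ + t := by ring
  change (∫ t, g (-(-θ - t)) * k t) + (∫ t, g (θ - t) * k t) = _
  simp only [hneg]
  rw [← MeasureTheory.integral_add (hint _ (by fun_prop)) (hint _ (by fun_prop)),
    intervalIntegral.integral_of_le Real.pi_pos.le,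
    ← MeasureTheory.integral_indicator measurableSet_Ioc]
  refine MeasureTheory.integral_congr_ae (.of_forall fun t => ?_)
  by_cases ht : t ∈ Ioc 0 π <;> simp [hkdef, ht, add_mul]
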